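/- arXiv:2007.07991 — 2 statements merged into one kernel-verified Lean document; each statement's English description precedes it below -/
import Mathlib

section
/- For every real r > 0, every l ≥ 0, and every natural number n ≥ ⌈r⌉, there exists a subset F of ℝⁿ with topological dimension 0 if l = 0, Lebesgue measure λ_n(F) = l, and Hausdorff dimension equal to r if l = 0 and equal to n if l > 0. -/
open scoped ENNReal
open MeasureTheory Set

universe u

/-- `IndLE n X t` means the small inductive dimension of `X` is `≤ n - 1`. -/
def IndLE : ℕ → (X : Type u) → TopologicalSpace X → Prop
  | 0, X, _ => IsEmpty X
  | n + 1, X, t => by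
      letI := t
      exact ∃ B : Set (Set X), TopologicalSpace.IsTopologicalBasis B ∧
        ∀ U ∈ B, IndLE n (frontier U) inferInstance

/-- Small inductive dimension ≤ 0. -/
def IndDimLEZero (X : Type u) [t : TopologicalSpace X] : Prop := IndLE 1 X t

/-- Small inductive (topological) dimension, as an extended nonnegative real:
the least `k : ℕ` such that `ind X ≤ k` (`⊤` if there is no finite bound). -/
noncomputable def indDim (X : Type u) [t : TopologicalSpace X] : ℝ≥0∞ :=
  sInf ((fun k : ℕ => (k : ℝ≥0∞)) '' {k : ℕ | IndLE (k + 1) X t})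

section ClopenBasis

/-- A space with a basis of clopen sets has small inductive dimension at most zero. -/
theorem IndDimLEZero.of_isTopologicalBasis_isClopen {X : Type u} [TopologicalSpace X]
    (h : TopologicalSpace.IsTopologicalBasis {U : Set X | IsClopen U}) : IndDimLEZero X := by
  refine ⟨_, h, fun U hU => ?_⟩
  change IsEmpty (frontier U)
  rw [IsClopen.frontier_eq hU]
  infer_instance

theorem IndDimLEZero.indDim_eq_zero {X : Type u} [TopologicalSpace X] (h : IndDimLEZero X) :
    indDim X = 0 :=
  le_antisymm (sInf_le ⟨0, h, by simp⟩) bot_le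

theorem Topology.IsInducing.isTopologicalBasis_isClopen_of_dense_compl {X ι : Type*}
    [TopologicalSpace X] [Finite ι] {f : X → ι → ℝ} (hf : Topology.IsInducing f) {S : Set ℝ}
    (hS : Dense Sᶜ) (hfS : ∀ x i, f x i ∈ S) :
    TopologicalSpace.IsTopologicalBasis {U : Set X | IsClopen U} := by
  cases nonempty_fintype ι
  refine TopologicalSpace.isTopologicalBasis_of_isOpen_of_nhds (fun U hU => hU.isOpen) ?_
  intro x U hxU hU
  obtain ⟨W, hW, rfl⟩ := hf.isOpen_iff.1 hU
  obtain ⟨ε, hε, hball⟩ := Metric.isOpen_iff.1 hW (f x) hxU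
  choose p hpS hp using fun i => hS.exists_between (sub_lt_self (f x i) hε)
  choose q hqS hq using fun i => hS.exists_between (lt_add_of_pos_right (f x i) hε)
  have hcont := hf.continuous
  have hopen : IsOpen (f ⁻¹' univ.pi fun i => Ioo (p i) (q i)) :=
    (isOpen_set_pi finite_univ fun i _ => isOpen_Ioo).preimage hcont
  have heq : (f ⁻¹' univ.pi fun i => Ioo (p i) (q i)) = f ⁻¹' univ.pi fun i => Icc (p i) (q i) := by
    ext y
    simp only [mem_preimage, mem_univ_pi]
    refine forall_congr' fun i => ⟨fun h => Ioo_subset_Icc_self h, fun h => ⟨?_, ?_⟩⟩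
    · exact h.1.lt_of_ne fun h' => hpS i (h' ▸ hfS y i)
    · exact h.2.lt_of_ne fun h' => hqS i (h' ▸ hfS y i)
  refine ⟨_, ⟨?_, hopen⟩, fun i _ => ⟨(hp i).2, (hq i).1⟩, fun y hy => hball ?_⟩
  · rw [heq]
    exact (isClosed_set_pi fun i _ => isClosed_Icc).preimage hcont
  · rw [Metric.mem_ball, dist_pi_lt_iff hε]
    intro i
    have h1 := hy i (mem_univ i)
    rw [Real.dist_eq, abs_lt]
    constructor <;> linarith [h1.1, h1.2, (hp i).1, (hq i).2]

end ClopenBasis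

section SymmetricCantorSet

open Filter Topology
open scoped NNReal

/-- The point of the symmetric Cantor set of contraction ratio `a` coded by `d`. -/
noncomputable def cantorPoint (a : ℝ) (d : ℕ → Fin 2) : ℝ :=
  ∑' j, (1 - a) * a ^ j * (d j : ℕ)

variable {a : ℝ}

theorem cantorPoint_term_le (ha0 : 0 ≤ a) (ha1 : a < 1) (d : ℕ → Fin 2) (j : ℕ) :
    (1 - a) * a ^ j * (d j : ℕ) ≤ (1 - a) * a ^ j := by
  have h1 : 0 ≤ 1 - a := by linarith
  have h2 : ((d j : ℕ) : ℝ) ≤ 1 := by exact_mod_cast Nat.lt_succ_iff.1 (d j).2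
  exact mul_le_of_le_one_right (by positivity) h2

theorem cantorPoint_term_nonneg (ha0 : 0 ≤ a) (ha1 : a < 1) (d : ℕ → Fin 2) (j : ℕ) :
    0 ≤ (1 - a) * a ^ j * (d j : ℕ) := by
  have h1 : 0 ≤ 1 - a := by linarith
  positivity

theorem summable_cantorPoint (ha0 : 0 ≤ a) (ha1 : a < 1) (d : ℕ → Fin 2) :
    Summable fun j => (1 - a) * a ^ j * (d j : ℕ) :=
  .of_nonneg_of_le (cantorPoint_term_nonneg ha0 ha1 d) (cantorPoint_term_le ha0 ha1 d)
    ((summable_geometric_of_lt_one ha0 ha1).mul_left _)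

theorem cantorPoint_nonneg (ha0 : 0 ≤ a) (ha1 : a < 1) (d : ℕ → Fin 2) : 0 ≤ cantorPoint a d :=
  tsum_nonneg (cantorPoint_term_nonneg ha0 ha1 d)

theorem cantorPoint_le_one (ha0 : 0 ≤ a) (ha1 : a < 1) (d : ℕ → Fin 2) : cantorPoint a d ≤ 1 := by
  refine ((summable_cantorPoint ha0 ha1 d).tsum_le_tsum (cantorPoint_term_le ha0 ha1 d)
    ((summable_geometric_of_lt_one ha0 ha1).mul_left _)).trans_eq ?_
  rw [tsum_mul_left, tsum_geometric_of_lt_one ha0 ha1]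
  exact mul_inv_cancel₀ (by linarith)

theorem cantorPoint_eq_add (ha0 : 0 ≤ a) (ha1 : a < 1) (d : ℕ → Fin 2) :
    cantorPoint a d = (1 - a) * (d 0 : ℕ) + a * cantorPoint a fun j => d (j + 1) := by
  rw [cantorPoint, (summable_cantorPoint ha0 ha1 d).tsum_eq_zero_add, cantorPoint, ← tsum_mul_left]
  congr 1
  · simp
  · exact tsum_congr fun j => by ring

theorem abs_cantorPoint_sub_le (ha0 : 0 ≤ a) (ha1 : a < 1) {d e : ℕ → Fin 2} {k : ℕ}
    (h : ∀ j < k, d j = e j) : |cantorPoint a d - cantorPoint a e| ≤ a ^ k := by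
  induction k generalizing d e with
  | zero =>
    rw [abs_le]
    constructor <;> linarith [cantorPoint_nonneg ha0 ha1 d, cantorPoint_nonneg ha0 ha1 e,
      cantorPoint_le_one ha0 ha1 d, cantorPoint_le_one ha0 ha1 e, pow_zero a]
  | succ k ih =>
    rw [cantorPoint_eq_add ha0 ha1 d, cantorPoint_eq_add ha0 ha1 e, h 0 k.succ_pos,
      add_sub_add_left_eq_sub, ← mul_sub, abs_mul, abs_of_nonneg ha0, pow_succ']
    exact mul_le_mul_of_nonneg_left (ih fun j hj => h (j + 1) (by lia)) ha0

theorem le_abs_cantorPoint_sub (ha0 : 0 ≤ a) (ha1 : a < 1) {d e : ℕ → Fin 2} {k : ℕ}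
    (h : ∀ j < k, d j = e j) (hk : d k ≠ e k) :
    (1 - 2 * a) * a ^ k ≤ |cantorPoint a d - cantorPoint a e| := by
  induction k generalizing d e with
  | zero =>
    rw [cantorPoint_eq_add ha0 ha1 d, cantorPoint_eq_add ha0 ha1 e, pow_zero, mul_one]
    have hd0 := mul_nonneg ha0 (cantorPoint_nonneg ha0 ha1 fun j => d (j + 1))
    have he0 := mul_nonneg ha0 (cantorPoint_nonneg ha0 ha1 fun j => e (j + 1))
    have hd1 := mul_le_of_le_one_right ha0 (cantorPoint_le_one ha0 ha1 fun j => d (j + 1))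
    have he1 := mul_le_of_le_one_right ha0 (cantorPoint_le_one ha0 ha1 fun j => e (j + 1))
    generalize d 0 = x at *
    generalize e 0 = y at *
    rw [le_abs]
    fin_cases x <;> fin_cases y <;> simp at hk ⊢
    · right; linarith
    · left; linarith
  | succ k ih =>
    rw [cantorPoint_eq_add ha0 ha1 d, cantorPoint_eq_add ha0 ha1 e, h 0 k.succ_pos,
      add_sub_add_left_eq_sub, ← mul_sub, abs_mul, abs_of_nonneg ha0, pow_succ', mul_left_comm]
    exact mul_le_mul_of_nonneg_left (ih (fun j hj => h (j + 1) (by lia)) hk) ha0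

theorem cantorPoint_injective (ha0 : 0 < a) (ha1 : a < 1 / 2) :
    Function.Injective (cantorPoint a) := by
  intro d e hde
  by_contra hne
  have hne' : ∃ k, d k ≠ e k := Function.ne_iff.1 hne
  classical
  have h := le_abs_cantorPoint_sub (k := Nat.find hne') ha0.le (by linarith)
    (fun j hj => not_not.1 (Nat.find_min hne' hj)) (Nat.find_spec hne')
  rw [hde, sub_self, abs_zero] at h
  have : 0 < (1 - 2 * a) * a ^ Nat.find hne' := mul_pos (by linarith) (by positivity)
  linarith

/-- The binary expansion is a Hölder function of the symmetric Cantor set. -/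
theorem abs_ofDigits_sub_le_cantorPoint (ha0 : 0 < a) (ha1 : a < 1 / 2) {s : ℝ} (hs : 0 ≤ s)
    (has : a ^ s = 1 / 2) (d e : ℕ → Fin 2) :
    |Real.ofDigits d - Real.ofDigits e| ≤
      ((1 - 2 * a)⁻¹) ^ s * |cantorPoint a d - cantorPoint a e| ^ s := by
  have h2a : 0 < 1 - 2 * a := by linarith
  by_cases hde : d = e
  · subst hde
    rw [sub_self, abs_zero]
    positivity
  have hne : ∃ k, d k ≠ e k := Function.ne_iff.1 hde
  classical
  have hlt : ∀ j < Nat.find hne, d j = e j := fun j hj => not_not.1 (Nat.find_min hne hj)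
  have h := le_abs_cantorPoint_sub ha0.le (by linarith) hlt (Nat.find_spec hne)
  calc |Real.ofDigits d - Real.ofDigits e| ≤ (((2 : ℕ) : ℝ) ^ Nat.find hne)⁻¹ :=
        Real.abs_ofDigits_sub_ofDigits_le hlt
    _ = (a ^ Nat.find hne) ^ s := by
        rw [← Real.rpow_pow_comm ha0.le, has]
        simp
    _ ≤ ((1 - 2 * a)⁻¹ * |cantorPoint a d - cantorPoint a e|) ^ s := by
        refine Real.rpow_le_rpow (by positivity) ?_ hs
        rw [← div_eq_inv_mul, le_div_iff₀ h2a]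
        linarith
    _ = _ := Real.mul_rpow (by positivity) (abs_nonneg _)

theorem dimH_pi_range_cantorPoint_le (n : ℕ) {s : ℝ≥0} (ha0 : 0 < a) (ha1 : a < 1)
    (has : a ^ (s : ℝ) = 1 / 2) :
    dimH (univ.pi fun _ : Fin n => range (cantorPoint a)) ≤ n * s := by
  have hcover := Measure.hausdorffMeasure_le_liminf_sum (ι := fun k => Fin n → Fin k → Fin 2)
    ((n * s : ℝ≥0) : ℝ) (univ.pi fun _ : Fin n => range (cantorPoint a)) (l := atTop)
    (fun k : ℕ => ENNReal.ofReal (a ^ k))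
    (by simpa using ENNReal.tendsto_ofReal (tendsto_pow_atTop_nhds_zero_of_lt_one ha0.le ha1))
    (fun k c => univ.pi fun i => cantorPoint a '' {d | ∀ j : Fin k, d j = c i j})
  have hdiam : ∀ (k : ℕ) (c : Fin n → Fin k → Fin 2),
      Metric.ediam (univ.pi fun i => cantorPoint a '' {d | ∀ j : Fin k, d j = c i j}) ≤
        ENNReal.ofReal (a ^ k) := by
    intro k c
    refine Metric.ediam_pi_le_of_le fun i => Metric.ediam_le ?_
    rintro _ ⟨d, hd, rfl⟩ _ ⟨e, he, rfl⟩
    rw [edist_dist, Real.dist_eq]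
    refine ENNReal.ofReal_le_ofReal (abs_cantorPoint_sub_le ha0.le ha1 fun j hj => ?_)
    rw [hd ⟨j, hj⟩, he ⟨j, hj⟩]
  specialize hcover (.of_forall hdiam) (.of_forall fun k x hx => ?_)
  · choose d hd using fun i => hx i (mem_univ i)
    exact mem_iUnion.2 ⟨fun i j => d i j, fun i _ => ⟨d i, fun j => rfl, hd i⟩⟩
  refine (dimH_le_of_hausdorffMeasure_ne_top (d := n * s) ?_).trans_eq (by simp)
  refine ne_top_of_le_ne_top ENNReal.one_ne_top (hcover.trans ?_)
  refine (liminf_le_liminf (v := fun _ => 1) (.of_forall fun k => ?_)).trans_eq (by simp)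
  refine (Finset.sum_le_sum fun c _ =>
    ENNReal.rpow_le_rpow (hdiam k c) (NNReal.coe_nonneg _)).trans_eq ?_
  have hpow : (a ^ k) ^ ((n * s : ℝ≥0) : ℝ) = (2 ^ k)⁻¹ ^ n := by
    rw [NNReal.coe_mul, mul_comm, Real.rpow_mul (by positivity), ← Real.rpow_pow_comm ha0.le, has]
    simp
  rw [ENNReal.ofReal_rpow_of_nonneg (by positivity) (NNReal.coe_nonneg _), hpow]
  simp only [Finset.sum_const, Finset.card_univ, Fintype.card_fun, Fintype.card_fin,
    nsmul_eq_mul]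
  rw [← ENNReal.ofReal_natCast, ← ENNReal.ofReal_mul (by positivity)]
  simp

theorem le_dimH_pi_range_cantorPoint (n : ℕ) {s : ℝ≥0} (hs : 0 < s) (ha0 : 0 < a)
    (ha1 : a < 1 / 2) (has : a ^ (s : ℝ) = 1 / 2) :
    n * s ≤ dimH (univ.pi fun _ : Fin n => range (cantorPoint a)) := by
  have h2a : 0 < 1 - 2 * a := by linarith
  set g : ℝ → ℝ := fun x => Real.ofDigits (Function.invFun (cantorPoint a) x) with hg
  have hgp : ∀ d, g (cantorPoint a d) = Real.ofDigits d := fun d => by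
    rw [hg]
    exact congrArg _ (Function.leftInverse_invFun (cantorPoint_injective ha0 ha1) d)
  have hholder : HolderOnWith (Real.toNNReal ((1 - 2 * a)⁻¹ ^ (s : ℝ))) s
      (fun (x : Fin n → ℝ) i => g (x i)) (univ.pi fun _ => range (cantorPoint a)) := by
    intro x hx y hy
    refine edist_pi_le_iff.2 fun i => ?_
    refine le_trans ?_
      (mul_le_mul_right (ENNReal.rpow_le_rpow (edist_le_pi_edist x y i) s.coe_nonneg) _)
    obtain ⟨d, hd⟩ := hx i (mem_univ i)
    obtain ⟨e, he⟩ := hy i (mem_univ i)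
    beta_reduce
    rw [← hd, ← he, hgp, hgp, edist_dist, edist_dist, Real.dist_eq, Real.dist_eq,
      ENNReal.ofReal_rpow_of_nonneg (abs_nonneg _) s.coe_nonneg]
    change _ ≤ ENNReal.ofReal _ * _
    rw [← ENNReal.ofReal_mul (by positivity)]
    exact ENNReal.ofReal_le_ofReal (abs_ofDigits_sub_le_cantorPoint ha0 ha1 s.coe_nonneg has d e)
  have himage : (Icc 0 1 : Set (Fin n → ℝ)) ⊆
      (fun (x : Fin n → ℝ) i => g (x i)) '' univ.pi fun _ => range (cantorPoint a) := by
    intro y hy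
    choose d _ hd using fun i =>
      Real.ofDigits_SurjOn (b := 2) one_lt_two (show y i ∈ Icc 0 1 from ⟨hy.1 i, hy.2 i⟩)
    exact ⟨fun i => cantorPoint a (d i), fun i _ => mem_range_self _,
      funext fun i => (hgp _).trans (hd i)⟩
  have hcube : dimH (Icc 0 1 : Set (Fin n → ℝ)) = n := by
    rw [Real.dimH_of_nonempty_interior, Module.finrank_fin_fun]
    refine ⟨fun _ => 1 / 2, ?_⟩
    rw [← pi_univ_Icc, interior_pi_set finite_univ]
    simp only [interior_Icc]
    intro i _
    norm_num
  have h := (hcube.symm.le.trans (dimH_mono himage)).trans (hholder.dimH_image_le hs)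
  exact (ENNReal.le_div_iff_mul_le (.inl (by simpa using hs.ne')) (.inl (by simp))).1 h

theorem exists_volume_eq_zero_dimH_pi_eq_mul {n : ℕ} (hn : 0 < n) {s : ℝ≥0} (hs0 : 0 < s)
    (hs1 : s < 1) :
    ∃ S : Set ℝ, volume S = 0 ∧ dimH (univ.pi fun _ : Fin n => S) = n * s := by
  have hs0' : (0 : ℝ) < s := hs0
  have hs1' : (s : ℝ) < 1 := hs1
  set a : ℝ := (1 / 2) ^ (s : ℝ)⁻¹ with ha
  have ha0 : 0 < a := by positivity
  have ha1 : a < 1 / 2 := by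
    simpa [ha] using Real.rpow_lt_rpow_of_exponent_gt (x := 1 / 2) (by norm_num) (by norm_num)
      ((one_lt_inv₀ hs0').2 hs1')
  have has : a ^ (s : ℝ) = 1 / 2 := Real.rpow_inv_rpow (by norm_num) hs0'.ne'
  have hdim := le_antisymm (dimH_pi_range_cantorPoint_le n ha0 (by linarith) has)
    (le_dimH_pi_range_cantorPoint n hs0 ha0 ha1 has)
  refine ⟨range (cantorPoint a), ?_, hdim⟩
  have hlt : dimH (univ.pi fun _ : Fin n => range (cantorPoint a)) < (n : ℝ≥0) := by
    rw [hdim]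
    exact_mod_cast mul_lt_of_lt_one_right (Nat.cast_pos.2 hn) hs1
  have hnull := hausdorffMeasure_of_dimH_lt hlt
  have hpi := hausdorffMeasure_pi_real (ι := Fin n)
  rw [Fintype.card_fin] at hpi
  rw [NNReal.coe_natCast, hpi, volume_pi_pi, Finset.prod_const] at hnull
  exact eq_zero_of_pow_eq_zero hnull

theorem exists_volume_eq_zero_dimH_pi_eq {n : ℕ} {r : ℝ} (hr : 0 < r) (hrn : r ≤ n) :
    ∃ S : Set ℝ, volume S = 0 ∧ dimH (univ.pi fun _ : Fin n => S) = ENNReal.ofReal r := by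
  have hn' : (0 : ℝ) < n := hr.trans_le hrn
  have hn : 0 < n := by exact_mod_cast hn'
  rcases hrn.lt_or_eq with hlt | rfl
  · obtain ⟨S, hS, hdim⟩ := exists_volume_eq_zero_dimH_pi_eq_mul hn (s := (r / n).toNNReal)
      (Real.toNNReal_pos.2 (by positivity)) (by simpa using (div_lt_one hn').2 hlt)
    refine ⟨S, hS, ?_⟩
    rw [hdim, ← ENNReal.ofReal_natCast]
    change _ * ENNReal.ofReal _ = _
    rw [← ENNReal.ofReal_mul hn'.le, mul_div_cancel₀ _ hn'.ne']
  · have hhalf : ∀ k : ℕ, ((1 : ℝ≥0) / 2) ^ (k + 1) < 1 := fun k =>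
      pow_lt_one₀ (by simp) (NNReal.half_lt_self one_ne_zero) k.succ_ne_zero
    choose S hS hdim using fun k : ℕ => exists_volume_eq_zero_dimH_pi_eq_mul hn
      (s := 1 - (1 / 2) ^ (k + 1)) (tsub_pos_of_lt (hhalf k))
      (tsub_lt_self one_pos (by positivity))
    refine ⟨⋃ k, S k, measure_iUnion_null hS, ?_⟩
    rw [ENNReal.ofReal_natCast]
    refine le_antisymm ((dimH_mono (subset_univ _)).trans_eq (Real.dimH_univ_pi_fin n)) ?_
    have hpow : Tendsto (fun k : ℕ => ((1 : ℝ≥0) / 2) ^ (k + 1)) atTop (𝓝 0) :=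
      (tendsto_pow_atTop_nhds_zero_of_lt_one (by simp)
        (NNReal.half_lt_self one_ne_zero)).comp (tendsto_add_atTop_nat 1)
    have hlim : Tendsto (fun k : ℕ => (((n : ℝ≥0) * (1 - (1 / 2) ^ (k + 1)) : ℝ≥0) : ℝ≥0∞)) atTop
        (𝓝 n) := by
      have := ENNReal.tendsto_coe.2 ((hpow.const_sub 1).const_mul (n : ℝ≥0))
      simpa using this
    refine le_of_tendsto' hlim fun k => ?_
    rw [ENNReal.coe_mul, ENNReal.coe_natCast, ← hdim k]
    exact dimH_mono (pi_mono fun _ _ => subset_iUnion S k)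

end SymmetricCantorSet

theorem EuclideanSpace.dimH_preimage_ofLp {n : ℕ} (A : Set (Fin n → ℝ)) :
    dimH (WithLp.ofLp ⁻¹' A : Set (EuclideanSpace ℝ (Fin n))) = dimH A :=
  (EuclideanSpace.equiv (Fin n) ℝ).dimH_preimage A

theorem EuclideanSpace.volume_preimage_ofLp {n : ℕ} (A : Set (Fin n → ℝ)) :
    volume (WithLp.ofLp ⁻¹' A : Set (EuclideanSpace ℝ (Fin n))) = volume A :=
  (EuclideanSpace.volume_preserving_symm_measurableEquiv_toLp (Fin n)).measure_preimage_equiv A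

/-- For every `r > 0`, `l ≥ 0` and `n ≥ ⌈r⌉` there is `F ⊆ ℝⁿ` with
topological dimension `0` when `l = 0`, Lebesgue measure `l`, and Hausdorff dimension
`r` if `l = 0` and `n` if `l > 0`. -/
theorem exists_fractal_euclidean (r l : ℝ) (hr : 0 < r) (hl : 0 ≤ l) (n : ℕ)
    (hn : ⌈r⌉₊ ≤ n) :
    ∃ F : Set (EuclideanSpace ℝ (Fin n)),
      (l = 0 → indDim ↥F = 0) ∧ volume F = ENNReal.ofReal l ∧
      dimH F = if l = 0 then ENNReal.ofReal r else (n : ℝ≥0∞) := by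
  have hrn : r ≤ n := Nat.ceil_le.1 hn
  have hn0 : n ≠ 0 := by
    rintro rfl
    exact hr.not_ge (by simpa using hrn)
  rcases hl.eq_or_lt with rfl | hl
  · obtain ⟨S, hS, hdim⟩ := exists_volume_eq_zero_dimH_pi_eq hr hrn
    refine ⟨WithLp.ofLp ⁻¹' univ.pi fun _ => S, fun _ => ?_, ?_, ?_⟩
    · refine (IndDimLEZero.of_isTopologicalBasis_isClopen ?_).indDim_eq_zero
      have hdense : Dense Sᶜ :=
        Measure.dense_of_ae (μ := volume) (measure_eq_zero_iff_ae_notMem.1 hS)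
      exact ((EuclideanSpace.equiv (Fin n) ℝ).toHomeomorph.isInducing.comp
        Topology.IsInducing.subtypeVal).isTopologicalBasis_isClopen_of_dense_compl hdense
        fun x i => x.2 i (mem_univ i)
    · rw [EuclideanSpace.volume_preimage_ofLp, volume_pi_pi, hS, Finset.prod_const,
        Finset.card_univ, Fintype.card_fin, zero_pow hn0, ENNReal.ofReal_zero]
    · rw [EuclideanSpace.dimH_preimage_ofLp, hdim, if_pos rfl]
  · have hroot : 0 < l ^ (n : ℝ)⁻¹ := by positivity
    refine ⟨WithLp.ofLp ⁻¹' univ.pi fun _ => Icc 0 (l ^ (n : ℝ)⁻¹),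
      fun h => absurd h hl.ne', ?_, ?_⟩
    · rw [EuclideanSpace.volume_preimage_ofLp, volume_pi_pi, Finset.prod_const, Real.volume_Icc,
        Finset.card_univ, Fintype.card_fin, sub_zero, ← ENNReal.ofReal_pow hroot.le,
        Real.rpow_inv_natCast_pow hl.le hn0]
    · rw [EuclideanSpace.dimH_preimage_ofLp, if_neg hl.ne', Real.dimH_of_nonempty_interior,
        Module.finrank_fin_fun]
      refine ⟨fun _ => l ^ (n : ℝ)⁻¹ / 2, ?_⟩
      rw [interior_pi_set finite_univ]
      simp only [interior_Icc]
      exact fun i _ => ⟨half_pos hroot, half_lt_self hroot⟩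
end

section
/- For every real r > 0, every l ≥ 0, and every n ≥ ⌈r⌉, the set of subsets F ⊆ ℝⁿ satisfying dim_H(F) = r·1_{l=0} + n·1_{l>0}, λ_n(F) = l, and topological dimension 0 has cardinality exactly 2^(2^ℵ₀) (beth-two). -/
open scoped ENNReal
open MeasureTheory Set

universe u

/-! ### Central Cantor sets -/

theorem cantorFunction_nonneg {c : ℝ} (h0 : 0 ≤ c) (f : ℕ → Bool) :
    0 ≤ Cardinal.cantorFunction c f :=
  tsum_nonneg fun _ => Cardinal.cantorFunctionAux_nonneg h0

theorem cantorFunction_le_inv {c : ℝ} (h0 : 0 ≤ c) (h1 : c < 1) (f : ℕ → Bool) :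
    Cardinal.cantorFunction c f ≤ (1 - c)⁻¹ := by
  rw [← tsum_geometric_of_lt_one h0 h1]
  refine (Cardinal.summable_cantor_function f h0 h1).tsum_le_tsum (fun n => ?_)
    (summable_geometric_of_lt_one h0 h1)
  cases h : f n <;> simp [h, pow_nonneg h0]

theorem abs_cantorFunction_sub_le {c : ℝ} (h0 : 0 ≤ c) (h1 : c < 1) (f g : ℕ → Bool) :
    |Cardinal.cantorFunction c f - Cardinal.cantorFunction c g| ≤ (1 - c)⁻¹ := by
  have := cantorFunction_nonneg h0 f
  have := cantorFunction_nonneg h0 g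
  have := cantorFunction_le_inv h0 h1 f
  have := cantorFunction_le_inv h0 h1 g
  rw [abs_le]
  constructor <;> linarith

theorem cantorFunction_sub_eq {c : ℝ} (h0 : 0 ≤ c) (h1 : c < 1) (m : ℕ) :
    ∀ f g : ℕ → Bool, (∀ k < m, f k = g k) →
      Cardinal.cantorFunction c f - Cardinal.cantorFunction c g =
        c ^ m * (Cardinal.cantorFunction c (fun k => f (k + m)) -
          Cardinal.cantorFunction c (fun k => g (k + m))) := by
  induction m with
  | zero => intro f g _; simp
  | succ m ih =>
    intro f g h
    rw [Cardinal.cantorFunction_succ f h0 h1, Cardinal.cantorFunction_succ g h0 h1,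
      h 0 (Nat.succ_pos m), add_sub_add_left_eq_sub, ← mul_sub,
      ih _ _ fun k hk => h (k + 1) (Nat.succ_lt_succ hk), ← mul_assoc, ← pow_succ']
    simp only [add_assoc, add_comm m 1]

theorem le_abs_cantorFunction_sub {c : ℝ} (h0 : 0 ≤ c) (h1 : c < 1) {f g : ℕ → Bool}
    (h : f 0 ≠ g 0) :
    1 - c * (1 - c)⁻¹ ≤ |Cardinal.cantorFunction c f - Cardinal.cantorFunction c g| := by
  rw [Cardinal.cantorFunction_succ f h0 h1, Cardinal.cantorFunction_succ g h0 h1]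
  have key := mul_le_mul_of_nonneg_left (abs_cantorFunction_sub_le h0 h1
    (fun n => f (n + 1)) (fun n => g (n + 1))) h0
  rw [← abs_of_nonneg h0, ← abs_mul, abs_of_nonneg h0, mul_sub, abs_le] at key
  rw [le_abs]
  cases hf : f 0 <;> cases hg : g 0
  · simp [hf, hg] at h
  · right; simp only [cond_false, cond_true]; linarith [key.1, key.2]
  · left; simp only [cond_false, cond_true]; linarith [key.1, key.2]
  · simp [hf, hg] at h

/-- The distance between two points of a central Cantor set of ratio `c < 1 / 2` controls, up to
a constant, the distance of the corresponding points for the ratio `c ^ e`. -/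
theorem exists_abs_cantorFunction_rpow_sub_le {c e : ℝ} (h0 : 0 < c) (h1 : c < 1 / 2)
    (he : 0 < e) :
    ∃ K : ℝ, 0 ≤ K ∧ ∀ f g : ℕ → Bool,
      |Cardinal.cantorFunction (c ^ e) f - Cardinal.cantorFunction (c ^ e) g| ≤
        K * |Cardinal.cantorFunction c f - Cardinal.cantorFunction c g| ^ e := by
  have hc1 : c < 1 := by linarith
  have hd0 : 0 ≤ c ^ e := Real.rpow_nonneg h0.le e
  have hd1 : c ^ e < 1 := Real.rpow_lt_one h0.le hc1 he
  have hδ : 0 < 1 - c * (1 - c)⁻¹ := by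
    rw [sub_pos, ← div_eq_mul_inv, div_lt_one (by linarith)]
    linarith
  set δ := 1 - c * (1 - c)⁻¹ with hδ_def
  have hinv : 0 ≤ (1 - c ^ e)⁻¹ := inv_nonneg.2 (by linarith)
  refine ⟨(1 - c ^ e)⁻¹ * (δ ^ e)⁻¹, by positivity, fun f g => ?_⟩
  by_cases hfg : f = g
  · subst hfg
    simp [Real.zero_rpow he.ne']
  have hne := PiNat.apply_firstDiff_ne hfg
  have heq : ∀ k < PiNat.firstDiff f g, f k = g k := fun k hk => PiNat.apply_eq_of_lt_firstDiff hk
  set m := PiNat.firstDiff f g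
  rw [cantorFunction_sub_eq hd0 hd1 m f g heq, cantorFunction_sub_eq h0.le hc1 m f g heq,
    abs_mul, abs_mul, abs_of_nonneg (pow_nonneg hd0 m), abs_of_nonneg (pow_nonneg h0.le m)]
  have hlow : δ ≤ |Cardinal.cantorFunction c (fun k => f (k + m)) -
      Cardinal.cantorFunction c (fun k => g (k + m))| :=
    le_abs_cantorFunction_sub h0.le hc1 (by simpa using hne)
  have hup := abs_cantorFunction_sub_le hd0 hd1 (fun k => f (k + m)) (fun k => g (k + m))
  rw [Real.mul_rpow (pow_nonneg h0.le m) (abs_nonneg _), ← Real.rpow_natCast, ← Real.rpow_natCast,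
    ← Real.rpow_mul h0.le, ← Real.rpow_mul h0.le, mul_comm (m : ℝ) e]
  have hpow := Real.rpow_le_rpow hδ.le hlow he.le
  have hδe : 0 < δ ^ e := Real.rpow_pos_of_pos hδ e
  have hce : 0 ≤ c ^ (e * (m : ℝ)) := Real.rpow_nonneg h0.le _
  calc _ ≤ c ^ (e * (m : ℝ)) * (1 - c ^ e)⁻¹ := mul_le_mul_of_nonneg_left hup hce
    _ = (1 - c ^ e)⁻¹ * (δ ^ e)⁻¹ * (c ^ (e * (m : ℝ)) * δ ^ e) := by field_simp
    _ ≤ _ := by gcongr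

theorem Icc_subset_range_cantorFunction_half :
    Icc (0 : ℝ) 1 ⊆ range (Cardinal.cantorFunction (1 / 2)) := by
  intro x hx
  obtain ⟨d, -, hd⟩ := Real.ofDigits_SurjOn (b := 2) one_lt_two
    (show x / 2 ∈ Icc (0 : ℝ) 1 from ⟨by linarith [hx.1], by linarith [hx.2]⟩)
  refine ⟨fun k => d k = 1, ?_⟩
  have : x = 2 * Real.ofDigits d := by rw [hd]; ring
  rw [this, Real.ofDigits, ← tsum_mul_left, Cardinal.cantorFunction]
  congr 1
  ext k
  have h : d k = 0 ∨ d k = 1 := by omega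
  rcases h with h | h
  · simp [Cardinal.cantorFunctionAux, Real.ofDigitsTerm, h]
  · simp [Cardinal.cantorFunctionAux, Real.ofDigitsTerm, h, pow_succ]

/-- The `n`-th power of a set of reals, as a subset of Euclidean space. -/
def coordCube (n : ℕ) (E : Set ℝ) : Set (EuclideanSpace ℝ (Fin n)) :=
  {x | ∀ i, x i ∈ E}

/-- The `n`-th power of the central Cantor set of ratio `c`. -/
def cantorCube (n : ℕ) (c : ℝ) : Set (EuclideanSpace ℝ (Fin n)) :=
  coordCube n (range (Cardinal.cantorFunction c))

theorem cantorCube_eq_preimage (n : ℕ) (c : ℝ) :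
    cantorCube n c = EuclideanSpace.equiv (Fin n) ℝ ⁻¹'
      univ.pi fun _ => range (Cardinal.cantorFunction c) := by
  ext x
  simp [cantorCube, coordCube]

theorem holderOnWith_pi {ι : Type*} [Fintype ι] {K e : NNReal} {φ : ℝ → ℝ} {s : Set ℝ}
    (h : HolderOnWith K e φ s) :
    HolderOnWith K e (fun (x : ι → ℝ) i => φ (x i)) (univ.pi fun _ => s) := by
  intro x hx y hy
  rw [edist_pi_le_iff]
  intro i
  refine (h (x i) (hx i trivial) (y i) (hy i trivial)).trans ?_
  gcongr
  exact edist_le_pi_edist x y i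

theorem exists_holderOnWith_cantor {c : ℝ} {e : NNReal} (h0 : 0 < c) (h1 : c < 1 / 2)
    (he : 0 < e) :
    ∃ (K : NNReal) (φ : ℝ → ℝ), HolderOnWith K e φ (range (Cardinal.cantorFunction c)) ∧
      φ '' range (Cardinal.cantorFunction c) = range (Cardinal.cantorFunction (c ^ (e : ℝ))) := by
  obtain ⟨K, hK, h⟩ := exists_abs_cantorFunction_rpow_sub_le h0 h1 (NNReal.coe_pos.2 he)
  have hinj := Function.leftInverse_invFun (Cardinal.cantorFunction_injective h0 h1)
  lift K to NNReal using hK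
  refine ⟨K, Cardinal.cantorFunction (c ^ (e : ℝ)) ∘
    Function.invFun (Cardinal.cantorFunction c), ?_, ?_⟩
  · rintro _ ⟨f, rfl⟩ _ ⟨g, rfl⟩
    simp only [Function.comp_apply, hinj f, hinj g]
    rw [edist_dist, edist_dist, ENNReal.ofReal_rpow_of_nonneg dist_nonneg e.coe_nonneg,
      ← ENNReal.ofReal_coe_nnreal, ← ENNReal.ofReal_mul K.coe_nonneg]
    exact ENNReal.ofReal_le_ofReal (h f g)
  · rw [← range_comp]
    congr 1
    ext f
    simp [hinj f]

theorem dimH_cantorCube_rpow_le (n : ℕ) {c : ℝ} {e : NNReal} (h0 : 0 < c) (h1 : c < 1 / 2)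
    (he : 0 < e) : dimH (cantorCube n (c ^ (e : ℝ))) ≤ dimH (cantorCube n c) / e := by
  obtain ⟨K, φ, hφ, him⟩ := exists_holderOnWith_cantor h0 h1 he
  rw [cantorCube_eq_preimage, cantorCube_eq_preimage, ContinuousLinearEquiv.dimH_preimage,
    ContinuousLinearEquiv.dimH_preimage]
  refine le_trans (dimH_mono ?_) ((holderOnWith_pi hφ).dimH_image_le he)
  rw [← him]
  intro y hy
  choose x hx hxy using fun i => hy i trivial
  exact ⟨x, fun i _ => hx i, funext hxy⟩

theorem dimH_le_natCast {n : ℕ} (s : Set (EuclideanSpace ℝ (Fin n))) : dimH s ≤ n := by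
  refine (dimH_mono (subset_univ s)).trans ?_
  simp [Real.dimH_univ_eq_finrank]

theorem dimH_cantorCube_half (n : ℕ) : dimH (cantorCube n (1 / 2)) = n := by
  rw [cantorCube_eq_preimage, ContinuousLinearEquiv.dimH_preimage,
    Real.dimH_of_nonempty_interior, Module.finrank_fin_fun]
  refine ⟨fun _ => 1 / 2, mem_interior_iff_mem_nhds.2 ?_⟩
  exact set_pi_mem_nhds finite_univ fun _ _ =>
    Filter.mem_of_superset (Icc_mem_nhds (by norm_num) (by norm_num))
      Icc_subset_range_cantorFunction_half

theorem volume_range_cantorFunction {c : ℝ} (h0 : 0 < c) (h1 : c < 1 / 2) :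
    volume (range (Cardinal.cantorFunction c)) = 0 := by
  obtain ⟨b, hcb, hb⟩ := exists_between h1
  have hb0 : 0 < b := h0.trans hcb
  have hlog : Real.log c < Real.log b := Real.log_lt_log h0 hcb
  have hlogb : Real.log b < 0 := Real.log_neg hb0 (by linarith)
  have he : 1 < Real.log c / Real.log b := by rwa [lt_div_iff_of_neg hlogb, one_mul]
  lift Real.log c / Real.log b to NNReal using by linarith with e hee
  have hbe : b ^ (e : ℝ) = c := by
    rw [hee, Real.rpow_def_of_pos hb0, mul_div_cancel₀ _ hlogb.ne, Real.exp_log h0]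
  have he' : 1 < e := by exact_mod_cast he
  obtain ⟨K, φ, hφ, him⟩ := exists_holderOnWith_cantor hb0 hb (zero_lt_one.trans he')
  rw [hbe] at him
  rw [← him, ← hausdorffMeasure_real]
  refine hausdorffMeasure_of_dimH_lt (d := 1) ?_
  refine (hφ.dimH_image_le (zero_lt_one.trans he')).trans_lt ?_
  have h1 : dimH (range (Cardinal.cantorFunction b)) ≤ 1 :=
    (dimH_mono (subset_univ _)).trans Real.dimH_univ.le
  refine (ENNReal.div_le_div_right h1 _).trans_lt ?_
  rw [ENNReal.div_lt_iff (by simp) (by simp)]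
  simpa using he'

theorem dimH_cantorCube_half_rpow (n : ℕ) {a : ℝ} (ha : 1 < a) :
    dimH (cantorCube n ((1 / 2) ^ a)) = ENNReal.ofReal (n / a) := by
  have ha0 : 0 < a := by linarith
  have hhalf : (0 : ℝ) < 1 / 2 := by norm_num
  have hlt : ∀ b : ℝ, 1 < b → (1 / 2 : ℝ) ^ b < 1 / 2 := fun b hb => by
    simpa using Real.rpow_lt_rpow_of_exponent_gt hhalf (by norm_num) hb
  have hpos : ∀ b : ℝ, 0 < (1 / 2 : ℝ) ^ b := fun b => Real.rpow_pos_of_pos hhalf b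
  apply le_antisymm
  · have hlim : Filter.Tendsto (fun b : ℝ => ENNReal.ofReal (n / (a / b))) (nhdsWithin 1 (Ioi 1))
        (nhds (ENNReal.ofReal (n / a))) := by
      refine (ENNReal.continuous_ofReal.tendsto _).comp ?_
      have : ContinuousAt (fun b : ℝ => (n : ℝ) / (a / b)) 1 := by
        refine continuousAt_const.div (continuousAt_const.div continuousAt_id one_ne_zero) ?_
        simpa using ha0.ne'
      simpa [ContinuousAt] using this.tendsto.mono_left nhdsWithin_le_nhds
    refine ge_of_tendsto hlim ?_
    filter_upwards [self_mem_nhdsWithin] with b hb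
    have hb0 : 0 < b := zero_lt_one.trans hb
    have he : 0 < a / b := div_pos ha0 hb0
    have h := dimH_cantorCube_rpow_le n (e := (a / b).toNNReal) (hpos b) (hlt b hb)
      (Real.toNNReal_pos.2 he)
    rw [Real.coe_toNNReal _ he.le, ← Real.rpow_mul hhalf.le, mul_div_cancel₀ _ hb0.ne'] at h
    refine h.trans ((ENNReal.div_le_div_right (dimH_le_natCast _) _).trans ?_)
    rw [ENNReal.ofReal_div_of_pos he, ENNReal.ofReal_natCast]
    rfl
  · have he : 0 < a⁻¹ := inv_pos.2 ha0
    have h := dimH_cantorCube_rpow_le n (e := a⁻¹.toNNReal) (hpos a) (hlt a ha)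
      (Real.toNNReal_pos.2 he)
    rw [Real.coe_toNNReal _ he.le, ← Real.rpow_mul hhalf.le, mul_inv_cancel₀ ha0.ne',
      Real.rpow_one, dimH_cantorCube_half] at h
    rw [div_eq_mul_inv, ENNReal.ofReal_mul n.cast_nonneg, ENNReal.ofReal_natCast]
    refine (mul_le_mul_left h _).trans_eq ?_
    exact ENNReal.div_mul_cancel (by simpa using he) ENNReal.ofReal_ne_top

/-- Powers of central Cantor sets realise every Hausdorff dimension strictly between `0` and the
dimension of the ambient space. -/
theorem exists_dimH_cantorCube_eq {n : ℕ} {t : ℝ} (h0 : 0 < t) (hn : t < n) :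
    ∃ c : ℝ, 0 < c ∧ c < 1 / 2 ∧ dimH (cantorCube n c) = ENNReal.ofReal t := by
  have ha : 1 < n / t := by rwa [lt_div_iff₀ h0, one_mul]
  have hhalf : (0 : ℝ) < 1 / 2 := by norm_num
  refine ⟨(1 / 2) ^ (n / t), Real.rpow_pos_of_pos hhalf _, ?_, ?_⟩
  · simpa using Real.rpow_lt_rpow_of_exponent_gt hhalf (by norm_num) ha
  · rw [dimH_cantorCube_half_rpow n ha, div_div_cancel₀]
    exact (h0.trans hn).ne'

theorem continuum_le_mk_cantorCube {n : ℕ} (hn : 0 < n) {c : ℝ} (h0 : 0 < c) (h1 : c < 1 / 2) :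
    Cardinal.continuum ≤ Cardinal.mk (cantorCube n c) := by
  have : Cardinal.mk (ℕ → Bool) = Cardinal.continuum := by simp
  rw [← this]
  refine Cardinal.mk_le_of_injective (f := fun f =>
    ⟨WithLp.toLp 2 fun _ => Cardinal.cantorFunction c f, fun _ => ⟨f, rfl⟩⟩) fun f g h => ?_
  exact Cardinal.cantorFunction_injective h0 h1
    (congrArg (fun x : cantorCube n c => x.1 ⟨0, hn⟩) h)

theorem volume_coordCube (n : ℕ) (E : Set ℝ) : volume (coordCube n E) = volume E ^ n := by
  have h := (EuclideanSpace.volume_preserving_symm_measurableEquiv_toLp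
    (Fin n)).measure_preimage_equiv (univ.pi fun _ => E)
  rw [volume_pi_pi, Finset.prod_const, Finset.card_univ, Fintype.card_fin] at h
  rw [← h]
  congr 1
  ext x
  simp [coordCube]

theorem coordCube_mono (n : ℕ) {E E' : Set ℝ} (h : E ⊆ E') : coordCube n E ⊆ coordCube n E' :=
  fun _ hx i => h (hx i)

theorem dimH_eq_natCast_of_volume_ne_zero {n : ℕ} {s : Set (EuclideanSpace ℝ (Fin n))}
    (h : volume s ≠ 0) : dimH s = n := by
  refine le_antisymm (dimH_le_natCast s) (not_lt.1 fun hlt => h ?_)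
  have : (Measure.hausdorffMeasure ((n : NNReal) : ℝ) :
      Measure (EuclideanSpace ℝ (Fin n))).IsAddHaarMeasure := by
    rw [NNReal.coe_natCast]
    infer_instance
  exact measure_zero_of_dimH_lt (d := n) (Measure.absolutelyContinuous_isAddHaarMeasure _ _)
    (by simpa using hlt)

/-! ### Zero-dimensional sets -/

theorem indDim_eq_zero_of_subset_coordCube {n : ℕ} {E : Set ℝ} (hE : Dense Eᶜ)
    {F : Set (EuclideanSpace ℝ (Fin n))} (hF : F ⊆ coordCube n E) : indDim F = 0 := by
  suffices h : IndLE 1 F inferInstance by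
    refine le_antisymm (sInf_le ⟨0, h, by simp⟩) zero_le
  refine ⟨{U | IsClopen U}, ?_, fun U hU => ?_⟩
  swap
  · change IsEmpty (frontier U)
    rw [IsClopen.frontier_eq hU]
    infer_instance
  refine TopologicalSpace.isTopologicalBasis_of_isOpen_of_nhds (fun U hU => hU.isOpen) ?_
  intro x U hx hU
  obtain ⟨V, hV, rfl⟩ := isOpen_induced_iff.1 hU
  have hV' : IsOpen ((EuclideanSpace.equiv (Fin n) ℝ).symm ⁻¹' V) :=
    hV.preimage (EuclideanSpace.equiv (Fin n) ℝ).symm.continuous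
  obtain ⟨ε, hε, hball⟩ := Metric.isOpen_iff.1 hV' (EuclideanSpace.equiv (Fin n) ℝ x) (by simpa)
  have hx' : ∀ i, x.1 i ∈ E := hF x.2
  choose a ha using fun i => hE.exists_between (sub_lt_self (x.1 i) hε)
  choose b hb using fun i => hE.exists_between (lt_add_of_pos_right (x.1 i) hε)
  have hcont : ∀ i, Continuous fun y : F => y.1 i := fun i => by fun_prop
  refine ⟨⋂ i, (fun y : F => y.1 i) ⁻¹' Ioo (a i) (b i), ?_, ?_, ?_⟩
  · refine isClopen_iInter_of_finite fun i => ⟨?_, isOpen_Ioo.preimage (hcont i)⟩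
    have : (fun y : F => y.1 i) ⁻¹' Ioo (a i) (b i) =
        (fun y : F => y.1 i) ⁻¹' Icc (a i) (b i) := by
      ext y
      have hy : y.1 i ∈ E := hF y.2 i
      have hya : y.1 i ≠ a i := fun h => (ha i).1 (h ▸ hy)
      have hyb : y.1 i ≠ b i := fun h => (hb i).1 (h ▸ hy)
      simp only [mem_preimage, mem_Ioo, mem_Icc, lt_iff_le_and_ne]
      exact ⟨fun h => ⟨h.1.1, h.2.1⟩, fun h => ⟨⟨h.1, hya.symm⟩, h.2, hyb⟩⟩
    rw [this]
    exact isClosed_Icc.preimage (hcont i)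
  · exact mem_iInter.2 fun i => ⟨(ha i).2.2, (hb i).2.1⟩
  · intro y hy
    have : EuclideanSpace.equiv (Fin n) ℝ y.1 ∈
        Metric.ball (EuclideanSpace.equiv (Fin n) ℝ x.1) ε := by
      rw [Metric.mem_ball, dist_pi_lt_iff hε]
      intro i
      have hyi := mem_iInter.1 hy i
      change |y.1 i - x.1 i| < ε
      rw [abs_lt]
      constructor <;> linarith [hyi.1, hyi.2, (ha i).2.1, (hb i).2.2]
    simpa using hball this

theorem exists_countable_dense_disjoint_of_volume_eq_zero {N : Set ℝ} (hN : volume N = 0) :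
    ∃ D : Set ℝ, D.Countable ∧ Dense D ∧ N ⊆ Dᶜ := by
  have hd : Dense Nᶜ := by
    rw [← interior_eq_empty_iff_dense_compl]
    exact Measure.interior_eq_empty_of_null hN
  obtain ⟨D, hDN, hDc, hDd⟩ := hd.exists_countable_dense_subset
  exact ⟨D, hDc, hDd, subset_compl_comm.1 hDN⟩

/-! ### Counting -/

theorem mk_setOf_eq_two_power_continuum {α : Type u} {p : Set α → Prop} (G Z : Set α)
    (hGZ : Disjoint G Z) (hα : Cardinal.mk α ≤ Cardinal.continuum)
    (hZ : Cardinal.continuum ≤ Cardinal.mk Z) (hp : ∀ S ⊆ Z, p (G ∪ S)) :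
    Cardinal.mk {F : Set α | p F} = 2 ^ Cardinal.continuum := by
  apply le_antisymm
  · refine (Cardinal.mk_set_le _).trans ?_
    rw [Cardinal.mk_set]
    exact Cardinal.power_le_power_left two_ne_zero hα
  · refine (Cardinal.power_le_power_left two_ne_zero hZ).trans ?_
    rw [← Cardinal.mk_powerset]
    refine Cardinal.mk_le_of_injective (f := fun S : 𝒫 Z => ⟨G ∪ S, hp S S.2⟩) ?_
    rintro ⟨S, hS⟩ ⟨T, hT⟩ h
    have h' : G ∪ S = G ∪ T := congrArg Subtype.val h
    have key : ∀ W ⊆ Z, (G ∪ W) \ G = W := fun W hW => by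
      rw [union_sdiff_left]
      exact (hGZ.mono_right hW).symm.sdiff_eq_left
    exact Subtype.ext (by change S = T; rw [← key S hS, h', key T hT])

theorem mk_euclideanSpace_le (n : ℕ) :
    Cardinal.mk (EuclideanSpace ℝ (Fin n)) ≤ Cardinal.continuum := by
  rw [Cardinal.mk_congr (EuclideanSpace.equiv (Fin n) ℝ).toEquiv]
  have : Cardinal.mk (Fin n → ℝ) = Cardinal.continuum ^ n := by simp [Cardinal.mk_real]
  rw [this]
  exact Cardinal.power_nat_le Cardinal.aleph0_le_continuum

theorem iSup_ofReal_mul_one_sub_inv {r : ℝ} (hr : 0 ≤ r) :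
    ⨆ k : ℕ, ENNReal.ofReal (r * (1 - 1 / ((k : ℝ) + 2))) = ENNReal.ofReal r := by
  apply le_antisymm
  · refine iSup_le fun k => ENNReal.ofReal_le_ofReal (mul_le_of_le_one_right hr ?_)
    have : (0 : ℝ) ≤ 1 / ((k : ℝ) + 2) := by positivity
    linarith
  · have hlim : Filter.Tendsto (fun k : ℕ => ENNReal.ofReal (r * (1 - 1 / ((k : ℝ) + 2))))
        Filter.atTop (nhds (ENNReal.ofReal (r * (1 - 0)))) := by
      refine (ENNReal.continuous_ofReal.tendsto _).comp
        (Filter.Tendsto.const_mul r (tendsto_const_nhds.sub ?_))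
      simp only [one_div]
      exact tendsto_inv_atTop_zero.comp
        (Filter.tendsto_atTop_add_const_right _ _ tendsto_natCast_atTop_atTop)
    rw [sub_zero, mul_one] at hlim
    exact le_of_tendsto' hlim fun k => le_iSup
      (fun k : ℕ => ENNReal.ofReal (r * (1 - 1 / ((k : ℝ) + 2)))) k

theorem mk_fractals_of_volume_eq_zero {r : ℝ} (hr : 0 < r) {n : ℕ} (hrn : r ≤ n) :
    Cardinal.mk {F : Set (EuclideanSpace ℝ (Fin n)) |
      dimH F = ENNReal.ofReal r ∧ volume F = 0 ∧ indDim F = 0} = 2 ^ Cardinal.continuum := by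
  have hn : 0 < n := Nat.cast_pos.1 (hr.trans_le hrn)
  have hfac : ∀ k : ℕ, (0 : ℝ) < 1 - 1 / ((k : ℝ) + 2) ∧ 1 - 1 / ((k : ℝ) + 2) < 1 := fun k => by
    have : (1 : ℝ) / ((k : ℝ) + 2) < 1 := by rw [div_lt_one (by positivity)]; linarith
    have : (0 : ℝ) < 1 / ((k : ℝ) + 2) := by positivity
    constructor <;> linarith
  choose c hc0 hc1 hc using fun k : ℕ => exists_dimH_cantorCube_eq (n := n)
    (mul_pos hr (hfac k).1) ((mul_lt_of_lt_one_right hr (hfac k).2).trans_le hrn)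
  obtain ⟨b, hb0, hb1, hb⟩ := exists_dimH_cantorCube_eq (n := n) (half_pos hr)
    ((half_lt_self hr).trans_le hrn)
  set N : Set ℝ := range (Cardinal.cantorFunction b) ∪ ⋃ k, range (Cardinal.cantorFunction (c k))
  have hN : volume N = 0 := measure_union_null (volume_range_cantorFunction hb0 hb1)
    (measure_iUnion_null fun k => volume_range_cantorFunction (hc0 k) (hc1 k))
  obtain ⟨D, -, hD, hND⟩ := exists_countable_dense_disjoint_of_volume_eq_zero hN
  set Z := cantorCube n b
  set U := ⋃ k, cantorCube n (c k) with hU_def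
  have hdimU : dimH U = ENNReal.ofReal r := by
    rw [hU_def, dimH_iUnion]
    simp_rw [hc]
    exact iSup_ofReal_mul_one_sub_inv hr.le
  have hdimZ : dimH Z < ENNReal.ofReal r := by
    rw [hb, ENNReal.ofReal_lt_ofReal_iff hr]
    exact half_lt_self hr
  refine mk_setOf_eq_two_power_continuum (U \ Z) Z disjoint_sdiff_left (mk_euclideanSpace_le n)
    (continuum_le_mk_cantorCube hn hb0 hb1) fun S hS => ?_
  have hsub : U \ Z ∪ S ⊆ coordCube n N := by
    rintro x (hx | hx)
    · obtain ⟨k, hk⟩ := mem_iUnion.1 hx.1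
      exact fun i => Or.inr (mem_iUnion.2 ⟨k, hk i⟩)
    · exact fun i => Or.inl (hS hx i)
  refine ⟨?_, ?_, ?_⟩
  · have hdiff : dimH (U \ Z) = ENNReal.ofReal r := by
      refine le_antisymm ((dimH_mono sdiff_subset).trans_eq hdimU) ?_
      have h : ENNReal.ofReal r ≤ max (dimH (U \ Z)) (dimH Z) := by
        rw [← dimH_union, ← hdimU]
        exact dimH_mono (by rw [sdiff_union_self]; exact subset_union_left)
      exact (le_max_iff.1 h).resolve_right hdimZ.not_ge
    rw [dimH_union, hdiff, max_eq_left ((dimH_mono hS).trans hdimZ.le)]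
  · refine measure_mono_null hsub ?_
    rw [volume_coordCube, hN, zero_pow hn.ne']
  · exact indDim_eq_zero_of_subset_coordCube (by rwa [compl_compl])
      (hsub.trans (coordCube_mono n hND))

theorem mk_fractals_of_volume_pos {l : ℝ} (hl : 0 < l) {n : ℕ} (hn : 0 < n) :
    Cardinal.mk {F : Set (EuclideanSpace ℝ (Fin n)) |
      dimH F = n ∧ volume F = ENNReal.ofReal l ∧ indDim F = 0} = 2 ^ Cardinal.continuum := by
  obtain ⟨b, hb0, hb1⟩ := exists_between (show (0 : ℝ) < 1 / 2 by norm_num)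
  set N := range (Cardinal.cantorFunction b) with hN_def
  have hN : volume N = 0 := volume_range_cantorFunction hb0 hb1
  obtain ⟨D, hDc, hD, hND⟩ := exists_countable_dense_disjoint_of_volume_eq_zero hN
  set G := coordCube n (Icc 0 (l ^ (n : ℝ)⁻¹) \ (D ∪ N)) with hG_def
  have hG : volume G = ENNReal.ofReal l := by
    rw [hG_def, volume_coordCube,
      measure_sdiff_null (measure_union_null (hDc.measure_zero volume) hN), Real.volume_Icc,
      sub_zero, ← ENNReal.ofReal_pow (Real.rpow_nonneg hl.le _),
      Real.rpow_inv_natCast_pow hl.le hn.ne']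
  refine mk_setOf_eq_two_power_continuum G (cantorCube n b) ?_ (mk_euclideanSpace_le n)
    (continuum_le_mk_cantorCube hn hb0 hb1) fun S hS => ?_
  · exact disjoint_left.2 fun x hx hx' => (hx ⟨0, hn⟩).2 (Or.inr (hx' ⟨0, hn⟩))
  have hSnull : volume S = 0 := measure_mono_null hS <| by
    rw [cantorCube, volume_coordCube, ← hN_def, hN, zero_pow hn.ne']
  have hvol : volume (G ∪ S) = ENNReal.ofReal l := by
    rw [measure_congr (union_ae_eq_left_of_ae_eq_empty (ae_eq_empty.2 hSnull)), hG]
  refine ⟨dimH_eq_natCast_of_volume_ne_zero ?_, hvol, ?_⟩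
  · rw [hvol]
    exact (ENNReal.ofReal_pos.2 hl).ne'
  · refine indDim_eq_zero_of_subset_coordCube (E := Dᶜ) (by rwa [compl_compl])
      (union_subset (coordCube_mono n fun x hx hxD => hx.2 (Or.inl hxD)) ?_)
    exact hS.trans (coordCube_mono n hND)

/-- General Hausdorff Dimension Theorem. For every `r > 0`, `l ≥ 0`
and `n ≥ ⌈r⌉`, the set of subsets of `ℝⁿ` of Hausdorff dimension `r·1_{l=0} + n·1_{l>0}`,
Lebesgue measure `l` and topological dimension `0` has cardinality exactly `2 ^ 𝔠`
(beth-two). -/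
theorem card_fractals_eq_bethTwo (r l : ℝ) (hr : 0 < r) (hl : 0 ≤ l) (n : ℕ)
    (hn : ⌈r⌉₊ ≤ n) :
    Cardinal.mk ↥{F : Set (EuclideanSpace ℝ (Fin n)) |
        dimH F = (if l = 0 then ENNReal.ofReal r else (n : ℝ≥0∞)) ∧
        volume F = ENNReal.ofReal l ∧ indDim ↥F = 0} =
      (2 : Cardinal) ^ Cardinal.continuum := by
  have hrn : r ≤ n := Nat.ceil_le.1 hn
  rcases hl.eq_or_lt with rfl | hl
  · simpa using mk_fractals_of_volume_eq_zero hr hrn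
  · simpa only [if_neg hl.ne'] using
      mk_fractals_of_volume_pos hl (Nat.cast_pos.1 (hr.trans_le hrn))
end
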